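/- arXiv:2305.02589 — 3 statements merged into one kernel-verified Lean document; each statement's English description precedes it below -/
import Mathlib

section
/- Let 𝒳, 𝒴 be finite sets, p a probability mass function on 𝒳×𝒴, and α∈(0,∞) with α≠1. Define the tilted probability mass function p̄ on 𝒳×𝒴 by p̄(x,y) = p(x|y)^α p(y) / ∑_{x',y'} p(x'|y')^α p(y'). Then H^H_α(X|Y)_p = H^A_{1/α}(X|Y)_{p̄}. -/
open Finset

variable {X Y : Type*} [Fintype X] [Fintype Y]

/-- `p` is a probability mass function on a finite type. -/
def IsPMF {Ω : Type*} [Fintype Ω] (p : Ω → ℝ) : Prop :=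
  (∀ ω, 0 ≤ p ω) ∧ ∑ ω, p ω = 1

/-- Marginal distribution of the second component. -/
noncomputable def margY (p : X × Y → ℝ) (y : Y) : ℝ := ∑ x, p (x, y)

/-- Conditional distribution `p(x|y)`. -/
noncomputable def condXY (p : X × Y → ℝ) (x : X) (y : Y) : ℝ := p (x, y) / margY p y

/-- Hayashi conditional Rényi entropy `H^H_α(X|Y)_p`. -/
noncomputable def HH (α : ℝ) (p : X × Y → ℝ) : ℝ :=
  (1 / (1 - α)) * Real.log (∑ y, margY p y * ∑ x, condXY p x y ^ α)

/-- Arimoto conditional Rényi entropy `H^A_α(X|Y)_p`. -/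
noncomputable def HA (α : ℝ) (p : X × Y → ℝ) : ℝ :=
  (α / (1 - α)) * Real.log (∑ y, margY p y * (∑ x, condXY p x y ^ α) ^ (1 / α))

/-- The tilted probability mass function `p̄`. -/
noncomputable def tilt (α : ℝ) (p : X × Y → ℝ) : X × Y → ℝ := fun (x, y) =>
  condXY p x y ^ α * margY p y / ∑ xy : X × Y, condXY p xy.1 xy.2 ^ α * margY p xy.2

lemma margY_nonneg {p : X × Y → ℝ} (hp : ∀ ω, 0 ≤ p ω) (y : Y) : 0 ≤ margY p y :=
  Finset.sum_nonneg fun x _ => hp (x, y)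

lemma condXY_nonneg {p : X × Y → ℝ} (hp : ∀ ω, 0 ≤ p ω) (x : X) (y : Y) :
    0 ≤ condXY p x y :=
  div_nonneg (hp _) (margY_nonneg hp y)

lemma sum_margY (p : X × Y → ℝ) : ∑ y, margY p y = ∑ ω, p ω := by
  rw [Fintype.sum_prod_type_right]
  rfl

lemma sum_condXY {p : X × Y → ℝ} {y : Y} (hy : margY p y ≠ 0) : ∑ x, condXY p x y = 1 := by
  simp only [condXY]
  rw [← Finset.sum_div]
  exact div_self hy

lemma sum_condXY_rpow_pos {p : X × Y → ℝ} (hp : ∀ ω, 0 ≤ p ω) (α : ℝ) {y : Y}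
    (hy : margY p y ≠ 0) : 0 < ∑ x, condXY p x y ^ α := by
  obtain ⟨x, -, hx⟩ := Finset.exists_ne_zero_of_sum_ne_zero
    (by rw [sum_condXY hy]; exact one_ne_zero : ∑ x, condXY p x y ≠ 0)
  exact Finset.sum_pos' (fun x _ => Real.rpow_nonneg (condXY_nonneg hp x y) α)
    ⟨x, Finset.mem_univ x, Real.rpow_pos_of_pos ((condXY_nonneg hp x y).lt_of_ne' hx) α⟩

lemma sum_margY_mul_pos {p : X × Y → ℝ} (hp : IsPMF p) (α : ℝ) :
    0 < ∑ y, margY p y * ∑ x, condXY p x y ^ α := by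
  obtain ⟨y, -, hy⟩ := Finset.exists_ne_zero_of_sum_ne_zero
    (by rw [sum_margY, hp.2]; exact one_ne_zero : ∑ y, margY p y ≠ 0)
  exact Finset.sum_pos'
    (fun y _ => mul_nonneg (margY_nonneg hp.1 y)
      (Finset.sum_nonneg fun x _ => Real.rpow_nonneg (condXY_nonneg hp.1 x y) α))
    ⟨y, Finset.mem_univ y,
      mul_pos ((margY_nonneg hp.1 y).lt_of_ne' hy) (sum_condXY_rpow_pos hp.1 α hy)⟩

lemma tilt_apply (α : ℝ) (p : X × Y → ℝ) (x : X) (y : Y) :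
    tilt α p (x, y) =
      condXY p x y ^ α * margY p y / ∑ y, margY p y * ∑ x, condXY p x y ^ α := by
  simp only [tilt, Fintype.sum_prod_type_right, ← Finset.sum_mul, mul_comm (margY p _)]

lemma margY_tilt (α : ℝ) (p : X × Y → ℝ) (y : Y) :
    margY (tilt α p) y =
      (∑ x, condXY p x y ^ α) * margY p y / ∑ y, margY p y * ∑ x, condXY p x y ^ α := by
  rw [margY]
  simp only [tilt_apply]
  rw [← Finset.sum_div, ← Finset.sum_mul]

lemma condXY_tilt {p : X × Y → ℝ} (hp : IsPMF p) (α : ℝ) (x : X) {y : Y}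
    (hy : margY p y ≠ 0) :
    condXY (tilt α p) x y = condXY p x y ^ α / ∑ x, condXY p x y ^ α := by
  rw [condXY, tilt_apply, margY_tilt, div_div_div_cancel_right₀ (sum_margY_mul_pos hp α).ne',
    mul_div_mul_right _ _ hy]

lemma sum_condXY_tilt_rpow {p : X × Y → ℝ} (hp : IsPMF p) {α : ℝ} (hα : α ≠ 0) {y : Y}
    (hy : margY p y ≠ 0) :
    (∑ x, condXY (tilt α p) x y ^ (1 / α)) ^ α = (∑ x, condXY p x y ^ α)⁻¹ := by
  have hS := sum_condXY_rpow_pos hp.1 α hy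
  have h (x : X) : condXY (tilt α p) x y ^ (1 / α) =
      condXY p x y / (∑ x, condXY p x y ^ α) ^ (1 / α) := by
    rw [condXY_tilt hp α x hy,
      Real.div_rpow (Real.rpow_nonneg (condXY_nonneg hp.1 x y) α) hS.le, one_div,
      Real.rpow_rpow_inv (condXY_nonneg hp.1 x y) hα]
  simp only [h]
  rw [← Finset.sum_div, sum_condXY hy, Real.div_rpow zero_le_one (Real.rpow_nonneg hS.le _),
    Real.one_rpow, one_div α, Real.rpow_inv_rpow hS.le hα, one_div]

/-- **Classical Rényi chain rule, first part**: `H^H_α(X|Y)_p = H^A_{1/α}(X|Y)_{p̄}`. -/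
theorem hayashi_eq_arimoto_tilted (p : X × Y → ℝ) (hp : IsPMF p)
    (α : ℝ) (hα0 : 0 < α) (hα1 : α ≠ 1) :
    HH α p = HA (1 / α) (tilt α p) := by
  have hterm (y : Y) :
      margY (tilt α p) y * (∑ x, condXY (tilt α p) x y ^ (1 / α)) ^ (1 / (1 / α)) =
        margY p y / ∑ y, margY p y * ∑ x, condXY p x y ^ α := by
    rw [one_div_one_div, margY_tilt]
    by_cases hy : margY p y = 0
    · simp [hy]
    · rw [sum_condXY_tilt_rpow hp hα0.ne' hy, div_mul_eq_mul_div, mul_right_comm,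
        mul_inv_cancel₀ (sum_condXY_rpow_pos hp.1 α hy).ne', one_mul]
  have hcoef : 1 / α / (1 - 1 / α) = -(1 / (1 - α)) := by
    have h₁ : 1 - α ≠ 0 := sub_ne_zero.mpr hα1.symm
    have h₂ : α - 1 ≠ 0 := sub_ne_zero.mpr hα1
    have h₃ : 1 - 1 / α = (α - 1) / α := by field_simp
    rw [h₃]
    field_simp
    ring
  rw [HH, HA, Finset.sum_congr rfl fun y _ => hterm y, ← Finset.sum_div, sum_margY, hp.2,
    one_div (∑ y, _), Real.log_inv, hcoef, neg_mul_neg]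
end

section
/- Let ρ_{AB} be a density matrix on ℂ^{d_A}⊗ℂ^{d_B} and α∈(0,∞) with α≠1. Define the tilted state ρ̄_{AB} = (ρ_B^{(1−α)/(2α)} ρ_{AB} ρ_B^{(1−α)/(2α)})^α / Tr[(ρ_B^{(1−α)/(2α)} ρ_{AB} ρ_B^{(1−α)/(2α)})^α]. Then H̃↓_α(A|B)_ρ = H̄↑_{1/α}(A|B)_{ρ̄}. -/
open Matrix Kronecker
open scoped ComplexOrder

/-- Real power of a matrix, defined spectrally for Hermitian matrices
(eigenvalue `0` is sent to `0` via `Real.rpow`); junk value `0` otherwise. -/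
noncomputable def mpow {n : Type*} [Fintype n] [DecidableEq n]
    (M : Matrix n n ℂ) (r : ℝ) : Matrix n n ℂ :=
  if hM : M.IsHermitian then
    (hM.eigenvectorUnitary : Matrix n n ℂ) *
      Matrix.diagonal (fun i => ((hM.eigenvalues i ^ r : ℝ) : ℂ)) *
        (star (hM.eigenvectorUnitary : Matrix n n ℂ))
  else 0

/-- Partial trace over the first tensor factor. -/
noncomputable def ptrA {dA dB : Type*} [Fintype dA]
    (M : Matrix (dA × dB) (dA × dB) ℂ) : Matrix dB dB ℂ :=
  Matrix.of fun b b' => ∑ a, M (a, b) (a, b')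

variable {dA dB : Type*} [Fintype dA] [Fintype dB] [DecidableEq dA] [DecidableEq dB]

/-- The sandwiched state `ρ_B^{(1−α)/(2α)} ρ_{AB} ρ_B^{(1−α)/(2α)}`. -/
noncomputable def sandwich (α : ℝ) (ρ : Matrix (dA × dB) (dA × dB) ℂ) :
    Matrix (dA × dB) (dA × dB) ℂ :=
  ((1 : Matrix dA dA ℂ) ⊗ₖ mpow (ptrA ρ) ((1 - α) / (2 * α))) * ρ *
    ((1 : Matrix dA dA ℂ) ⊗ₖ mpow (ptrA ρ) ((1 - α) / (2 * α)))

/-- The conditional Rényi entropy `H̃↓_α(A|B)_ρ`. -/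
noncomputable def Hdown (α : ℝ) (ρ : Matrix (dA × dB) (dA × dB) ℂ) : ℝ :=
  (1 / (1 - α)) * Real.log (mpow (sandwich α ρ) α).trace.re

/-- The conditional Rényi entropy `H̄↑_α(A|B)_ρ`. -/
noncomputable def Hup (α : ℝ) (ρ : Matrix (dA × dB) (dA × dB) ℂ) : ℝ :=
  (α / (1 - α)) * Real.log (mpow (ptrA (mpow ρ α)) (1 / α)).trace.re

/-- The tilted state `ρ̄_{AB}`. -/
noncomputable def qtilt (α : ℝ) (ρ : Matrix (dA × dB) (dA × dB) ℂ) :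
    Matrix (dA × dB) (dA × dB) ℂ :=
  ((mpow (sandwich α ρ) α).trace)⁻¹ • mpow (sandwich α ρ) α

section RealPower

variable {n : Type*} [Fintype n] [DecidableEq n] {M : Matrix n n ℂ}

lemma mpow_eq_cfc (hM : M.IsHermitian) (r : ℝ) : mpow M r = cfc (fun x : ℝ => x ^ r) M := by
  rw [hM.cfc_eq, Matrix.IsHermitian.cfc, Unitary.conjStarAlgAut_apply, mpow, dif_pos hM]
  rfl

lemma Matrix.PosSemidef.nonneg_of_mem_spectrum (hM : M.PosSemidef) {x : ℝ}
    (hx : x ∈ spectrum ℝ M) : 0 ≤ x := by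
  obtain ⟨i, rfl⟩ := hM.isHermitian.spectrum_real_eq_range_eigenvalues ▸ hx
  exact hM.eigenvalues_nonneg i

lemma continuousOn_spectrum (f : ℝ → ℝ) : ContinuousOn f (spectrum ℝ M) :=
  M.finite_real_spectrum.continuousOn f

lemma posSemidef_mpow (hM : M.PosSemidef) (r : ℝ) : (mpow M r).PosSemidef := by
  rw [mpow, dif_pos hM.isHermitian, star_eq_conjTranspose]
  refine (Matrix.PosSemidef.diagonal fun i => ?_).mul_mul_conjTranspose_same _
  exact Complex.zero_le_real.2 (Real.rpow_nonneg (hM.eigenvalues_nonneg i) r)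

lemma mpow_one (hM : M.IsHermitian) : mpow M 1 = M := by
  simp_rw [mpow_eq_cfc hM, Real.rpow_one]
  exact cfc_id' ℝ M hM.isSelfAdjoint

lemma mpow_mpow (hM : M.PosSemidef) (a b : ℝ) : mpow (mpow M a) b = mpow M (a * b) := by
  rw [mpow_eq_cfc (posSemidef_mpow hM a).isHermitian, mpow_eq_cfc hM.isHermitian,
    mpow_eq_cfc hM.isHermitian, ← cfc_comp' (fun x : ℝ => x ^ b) (fun x : ℝ => x ^ a) M
      ((M.finite_real_spectrum.image _).continuousOn _) (continuousOn_spectrum _)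
      hM.isHermitian.isSelfAdjoint]
  exact cfc_congr fun x hx => (Real.rpow_mul (hM.nonneg_of_mem_spectrum hx) a b).symm

lemma mpow_smul (hM : M.PosSemidef) {c : ℝ} (hc : 0 ≤ c) (r : ℝ) :
    mpow (c • M) r = c ^ r • mpow M r := by
  have hcM : (c • M).IsHermitian := (IsSelfAdjoint.all c).smul hM.isHermitian.isSelfAdjoint
  rw [mpow_eq_cfc hcM, mpow_eq_cfc hM.isHermitian,
    ← cfc_comp_const_mul c (fun x : ℝ => x ^ r) M
      ((M.finite_real_spectrum.image _).continuousOn _) hM.isHermitian.isSelfAdjoint,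
    ← cfc_const_mul _ _ M (continuousOn_spectrum _)]
  exact cfc_congr fun x hx => Real.mul_rpow hc (hM.nonneg_of_mem_spectrum hx)

lemma mpow_mul_self_mul_mpow (hM : M.PosSemidef) {s : ℝ} (hs : s + 1 + s ≠ 0) :
    mpow M s * M * mpow M s = mpow M (s + 1 + s) := by
  rw [mpow_eq_cfc hM.isHermitian, mpow_eq_cfc hM.isHermitian]
  nth_rw 2 [← cfc_id' ℝ M hM.isHermitian.isSelfAdjoint]
  rw [← cfc_mul _ _ M (continuousOn_spectrum _) (continuousOn_spectrum _),
    ← cfc_mul _ _ M (continuousOn_spectrum _) (continuousOn_spectrum _)]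
  refine cfc_congr fun x hx => ?_
  rcases (hM.nonneg_of_mem_spectrum hx).eq_or_lt with rfl | hx0
  · simp [Real.zero_rpow hs]
  · simp [Real.rpow_add hx0]

end RealPower

section PartialTrace

lemma posSemidef_ptrA {dA dB : Type*} [Fintype dA] {M : Matrix (dA × dB) (dA × dB) ℂ}
    (hM : M.PosSemidef) : (ptrA M).PosSemidef := by
  have h : ptrA M = ∑ a, M.submatrix (Prod.mk a) (Prod.mk a) := by
    ext b b'
    simp [ptrA, Matrix.sum_apply]
  rw [h]
  exact Matrix.posSemidef_sum _ fun a _ => hM.submatrix _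

lemma ptrA_smul {dA dB : Type*} [Fintype dA] (c : ℝ) (M : Matrix (dA × dB) (dA × dB) ℂ) :
    ptrA (c • M) = c • ptrA M := by
  ext b b'
  simp [ptrA, Finset.mul_sum]

lemma trace_ptrA {dA dB : Type*} [Fintype dA] [Fintype dB] (M : Matrix (dA × dB) (dA × dB) ℂ) :
    (ptrA M).trace = M.trace := by
  simp only [Matrix.trace, Matrix.diag, ptrA, Matrix.of_apply, Fintype.sum_prod_type]
  exact Finset.sum_comm

lemma ptrA_one_kronecker_mul_mul {dA dB : Type*} [Fintype dA] [Fintype dB] [DecidableEq dA]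
    (K L : Matrix dB dB ℂ) (M : Matrix (dA × dB) (dA × dB) ℂ) :
    ptrA (((1 : Matrix dA dA ℂ) ⊗ₖ K) * M * ((1 : Matrix dA dA ℂ) ⊗ₖ L)) = K * ptrA M * L := by
  ext b b'
  simp only [ptrA, Matrix.of_apply, Matrix.mul_apply, Matrix.kroneckerMap_apply, Matrix.one_apply,
    Fintype.sum_prod_type, ite_mul, one_mul, zero_mul, mul_ite, mul_zero, Finset.sum_ite_irrel,
    Finset.sum_const_zero, Finset.sum_ite_eq, Finset.sum_ite_eq', Finset.mem_univ, if_true,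
    Finset.sum_mul, Finset.mul_sum]
  rw [Finset.sum_comm]
  refine Finset.sum_congr rfl fun c _ => ?_
  rw [Finset.sum_comm]

end PartialTrace

lemma posSemidef_sandwich {ρ : Matrix (dA × dB) (dA × dB) ℂ} (hρ : ρ.PosSemidef) (α : ℝ) :
    (sandwich α ρ).PosSemidef := by
  have h := hρ.mul_mul_conjTranspose_same
    ((1 : Matrix dA dA ℂ) ⊗ₖ mpow (ptrA ρ) ((1 - α) / (2 * α)))
  rwa [Matrix.conjTranspose_kronecker, Matrix.conjTranspose_one,
    (posSemidef_mpow (posSemidef_ptrA hρ) _).isHermitian.eq] at h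

lemma ptrA_sandwich {ρ : Matrix (dA × dB) (dA × dB) ℂ} (hρ : ρ.PosSemidef) {α : ℝ} (hα : α ≠ 0) :
    ptrA (sandwich α ρ) = mpow (ptrA ρ) (1 / α) := by
  have h : (1 - α) / (2 * α) + 1 + (1 - α) / (2 * α) = 1 / α := by field_simp; ring
  rw [sandwich, ptrA_one_kronecker_mul_mul,
    mpow_mul_self_mul_mpow (posSemidef_ptrA hρ) (h ▸ one_div_ne_zero hα), h]

theorem quantum_renyi_chain_rule_bipartite
    (ρ : Matrix (dA × dB) (dA × dB) ℂ) (hρ : ρ.PosSemidef) (htr : ρ.trace = 1)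
    (α : ℝ) (hα0 : 0 < α) (hα1 : α ≠ 1) :
    Hdown α ρ = Hup (1 / α) (qtilt α ρ) := by
  have hX := posSemidef_sandwich hρ α
  have hσ := posSemidef_ptrA hρ
  have hXα := posSemidef_mpow hX α
  set t : ℝ := (mpow (sandwich α ρ) α).trace.re with ht
  have ht0 : 0 ≤ t := (Complex.nonneg_iff.1 hXα.trace_nonneg).1
  have hinv : 0 ≤ t⁻¹ := inv_nonneg.2 ht0
  have htilt : qtilt α ρ = t⁻¹ • mpow (sandwich α ρ) α := by
    have htC : (mpow (sandwich α ρ) α).trace = (t : ℂ) :=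
      Complex.ext rfl (Complex.nonneg_iff.1 hXα.trace_nonneg).2.symm
    rw [qtilt, htC, ← Complex.ofReal_inv, Complex.coe_smul]
  have hroot : mpow (qtilt α ρ) (1 / α) = t⁻¹ ^ (1 / α) • sandwich α ρ := by
    rw [htilt, mpow_smul hXα hinv, mpow_mpow hX, mul_one_div_cancel hα0.ne', mpow_one hX.isHermitian]
  have hmarg : mpow (ptrA (mpow (qtilt α ρ) (1 / α))) α = t⁻¹ • ptrA ρ := by
    rw [hroot, ptrA_smul, ptrA_sandwich hρ hα0.ne',
      mpow_smul (posSemidef_mpow hσ _) (Real.rpow_nonneg hinv _), mpow_mpow hσ,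
      one_div_mul_cancel hα0.ne', mpow_one hσ.isHermitian, ← Real.rpow_mul hinv,
      one_div_mul_cancel hα0.ne', Real.rpow_one]
  have hcoef : 1 / α / (1 - 1 / α) = -(1 / (1 - α)) := by
    have h1 : 1 - α ≠ 0 := sub_ne_zero.2 hα1.symm
    have h2 : α - 1 ≠ 0 := sub_ne_zero.2 hα1
    have h3 : 1 - 1 / α = (α - 1) / α := by field_simp
    rw [h3]
    field_simp
    ring
  rw [Hdown, Hup, one_div_one_div, hmarg, Matrix.trace_smul, trace_ptrA, htr, hcoef, ← ht]
  simp [Real.log_inv]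
end

section
/- Let σ^{(1)}_0,σ^{(1)}_1 be density matrices on ℂ^{d_1} and σ^{(2)}_0,σ^{(2)}_1 density matrices on ℂ^{d_2}, and for i=1,2 let P_i = P^pg(X_i|B_i) be the pretty-good-measurement guessing probability of the cq state ½|0⟩⟨0|⊗σ^{(i)}_0 + ½|1⟩⟨1|⊗σ^{(i)}_1. Let ρ'_{Z B_1B_2} = ∑_{z∈{0,1}} ½|z⟩⟨z|⊗ρ_z with ρ_z = ½∑_{x∈{0,1}} σ^{(1)}_{z⊕x}⊗σ^{(2)}_x (the cq state of Z=X_1⊕X_2 with side information B_1B_2). Then the pretty-good-measurement guessing probability of ρ' satisfies P^pg(Z|B_1B_2) = 2(½ − P_1)(½ − P_2) + ½. -/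
open Matrix Kronecker
open scoped ComplexOrder

variable {dA dB : Type*} [Fintype dA] [Fintype dB] [DecidableEq dA] [DecidableEq dB]

/-- The pretty-good-measurement guessing probability
`P^pg(X|B) = ∑ₓ q(x)·Tr[σₓ Mₓ]` with `Mₓ = ρ_B^{−1/2} q(x) σₓ ρ_B^{−1/2}`. -/
noncomputable def pgGuess {X d : Type*} [Fintype X] [Fintype d] [DecidableEq d]
    (q : X → ℝ) (σ : X → Matrix d d ℂ) : ℝ :=
  ∑ x, q x *
    ((σ x * (mpow (∑ x', ((q x' : ℝ) : ℂ) • σ x') (-(1/2)) *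
      (((q x : ℝ) : ℂ) • σ x) *
        mpow (∑ x', ((q x' : ℝ) : ℂ) • σ x') (-(1/2)))).trace.re)

theorem mpow_unitary_conj_diagonal {n : Type*} [Fintype n] [DecidableEq n] {M U : Matrix n n ℂ}
    (hU : U * star U = 1) {d : n → ℝ}
    (hM : M = U * diagonal (fun i => (d i : ℂ)) * star U) (r : ℝ) :
    mpow M r = U * diagonal (fun i => ((d i ^ r : ℝ) : ℂ)) * star U := by
  have hH : M.IsHermitian := by
    have hd : star (diagonal (fun i => (d i : ℂ))) = diagonal (fun i => (d i : ℂ)) := by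
      ext i j
      by_cases h : i = j <;> simp [h, Ne.symm]
    rw [IsHermitian, ← star_eq_conjTranspose, hM]
    simp only [star_mul, star_star, hd, mul_assoc]
  have hU' : star U * U = 1 := mul_eq_one_comm.mp hU
  rw [mpow, dif_pos hH]
  set V := (hH.eigenvectorUnitary : Matrix n n ℂ)
  have hV : V * star V = 1 := Unitary.coe_mul_star_self hH.eigenvectorUnitary
  have hV' : star V * V = 1 := Unitary.coe_star_mul_self hH.eigenvectorUnitary
  have hMV : M = V * diagonal (fun i => (hH.eigenvalues i : ℂ)) * star V := by
    conv_lhs => rw [hH.spectral_theorem]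
    rfl
  clear_value V
  generalize hH.eigenvalues = e at hMV ⊢
  -- the change of basis intertwines the two diagonal forms, hence any function of them
  have hW : diagonal (fun i => (e i : ℂ)) * (star V * U) =
      star V * U * diagonal (fun i => (d i : ℂ)) := by
    calc _ = star V * V * diagonal (fun i => (e i : ℂ)) * star V * U := by
            rw [hV', one_mul, mul_assoc]
      _ = star V * M * U := by rw [hMV]; simp only [mul_assoc]
      _ = star V * U * diagonal (fun i => (d i : ℂ)) * (star U * U) := by
            rw [hM]; simp only [mul_assoc]
      _ = _ := by rw [hU', mul_one]
  have hWr : diagonal (fun i => ((e i ^ r : ℝ) : ℂ)) * (star V * U) =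
      star V * U * diagonal (fun i => ((d i ^ r : ℝ) : ℂ)) := by
    ext i j
    have h := congrFun (congrFun hW i) j
    rw [diagonal_mul, mul_diagonal, mul_comm] at h ⊢
    by_cases h0 : (star V * U) i j = 0
    · simp [h0]
    · rw [Complex.ofReal_injective (mul_left_cancel₀ h0 h)]
  calc _ = V * (diagonal (fun i => ((e i ^ r : ℝ) : ℂ)) * (star V * U)) * star U := by
          simp only [mul_assoc, hU, mul_one]
    _ = V * star V * U * diagonal (fun i => ((d i ^ r : ℝ) : ℂ)) * star U := by
          rw [hWr]; simp only [mul_assoc]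
    _ = _ := by rw [hV, one_mul]

theorem Matrix.PosSemidef.exists_unitary_diagonal {n : Type*} [Fintype n] [DecidableEq n]
    {M : Matrix n n ℂ} (hM : M.PosSemidef) :
    ∃ (U : Matrix n n ℂ) (d : n → ℝ), U * star U = 1 ∧ (∀ i, 0 ≤ d i) ∧
      M = U * diagonal (fun i => (d i : ℂ)) * star U := by
  refine ⟨hM.1.eigenvectorUnitary, hM.1.eigenvalues,
    Unitary.coe_mul_star_self _, hM.eigenvalues_nonneg, ?_⟩
  conv_lhs => rw [hM.1.spectral_theorem]
  rfl

theorem mpow_kronecker {m n : Type*} [Fintype m] [DecidableEq m] [Fintype n] [DecidableEq n]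
    {A : Matrix m m ℂ} {B : Matrix n n ℂ} (hA : A.PosSemidef) (hB : B.PosSemidef) (r : ℝ) :
    mpow (A ⊗ₖ B) r = mpow A r ⊗ₖ mpow B r := by
  obtain ⟨U, a, hU, ha, hAU⟩ := hA.exists_unitary_diagonal
  obtain ⟨V, b, hV, hb, hBV⟩ := hB.exists_unitary_diagonal
  have hstar : star (U ⊗ₖ V) = star U ⊗ₖ star V := conjTranspose_kronecker U V
  rw [mpow_unitary_conj_diagonal hU hAU, mpow_unitary_conj_diagonal hV hBV,
    mpow_unitary_conj_diagonal (U := U ⊗ₖ V) (d := fun p => a p.1 * b p.2)]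
  · simp only [hstar, mul_kronecker_mul, diagonal_kronecker_diagonal]
    simp [Real.mul_rpow (ha _) (hb _)]
  · rw [hstar, ← mul_kronecker_mul, hU, hV, one_kronecker_one]
  · rw [hAU, hBV]
    simp only [hstar, mul_kronecker_mul, diagonal_kronecker_diagonal, Complex.ofReal_mul]

theorem mpow_isHermitian {n : Type*} [Fintype n] [DecidableEq n] (M : Matrix n n ℂ) (r : ℝ) :
    (mpow M r).IsHermitian := by
  unfold mpow
  split_ifs with h
  · refine isHermitian_mul_mul_conjTranspose _ (isHermitian_diagonal_of_self_adjoint _ ?_)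
    ext i
    simp
  · exact isHermitian_zero

theorem mul_mpow_neg_half_mul_mul_mpow_neg_half {n : Type*} [Fintype n] [DecidableEq n]
    {M : Matrix n n ℂ} (hM : M.PosSemidef) :
    M * mpow M (-(1/2)) * M * mpow M (-(1/2)) = M := by
  obtain ⟨U, d, hU, hd, hMU⟩ := hM.exists_unitary_diagonal
  have hU' : star U * U = 1 := mul_eq_one_comm.mp hU
  have hcancel : ∀ X : Matrix n n ℂ, star U * (U * X) = X := fun X => by
    rw [← mul_assoc, hU', one_mul]
  have hdiag : ∀ i, d i * (d i ^ (-(1/2) : ℝ) * (d i * d i ^ (-(1/2) : ℝ))) = d i := fun i => by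
    rcases (hd i).eq_or_lt with h | h
    · simp [← h]
    · have : d i ^ (-(1/2) : ℝ) * d i ^ (-(1/2) : ℝ) * d i = 1 := by
        rw [← Real.rpow_add h, ← Real.rpow_add_one h.ne']
        norm_num
      linear_combination d i * this
  rw [mpow_unitary_conj_diagonal hU hMU]
  conv_rhs => rw [hMU]
  rw [hMU]
  simp only [mul_assoc, hcancel]
  simp only [← mul_assoc, diagonal_mul_diagonal]
  simp only [mul_assoc, ← Complex.ofReal_mul, hdiag]

/-- With `R` the mean of two states and `D` half their difference, the guessing probability is
`½ + ½ Tr[D R^{-1/2} D R^{-1/2}]`. -/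
theorem pgGuess_add_sub {n : Type*} [Fintype n] [DecidableEq n]
    {R D : Matrix n n ℂ} (hR : R.PosSemidef) (htr : R.trace = 1)
    {σ : ZMod 2 → Matrix n n ℂ} (h0 : σ 0 = R + D) (h1 : σ 1 = R - D) :
    pgGuess (fun _ : ZMod 2 => 1/2) σ =
      1/2 + 1/2 * (D * mpow R (-(1/2)) * D * mpow R (-(1/2))).trace.re := by
  have hsum : ∀ f : ZMod 2 → Matrix n n ℂ, ∑ x, f x = f 0 + f 1 := Fin.sum_univ_two
  have hsum' : ∀ f : ZMod 2 → ℝ, ∑ x, f x = f 0 + f 1 := Fin.sum_univ_two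
  have hmean : (((1/2 : ℝ) : ℂ) • σ 0 + ((1/2 : ℝ) : ℂ) • σ 1) = R := by
    rw [h0, h1]
    module
  have hRR := congrArg (fun M => (trace M).re) (mul_mpow_neg_half_mul_mul_mpow_neg_half hR)
  simp only [htr, Complex.one_re] at hRR
  simp only [pgGuess, hsum, hsum', hmean]
  rw [h0, h1]
  simp only [mul_add, add_mul, mul_sub, sub_mul, mul_smul_comm, smul_mul_assoc, smul_add, smul_sub,
    trace_add, trace_sub, trace_smul, smul_eq_mul, Complex.add_re, Complex.sub_re,
    Complex.re_ofReal_mul, ← mul_assoc] at hRR ⊢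
  linear_combination (1/2) * hRR

theorem trace_mul_mul_mul_im_eq_zero {n : Type*} [Fintype n] {D S : Matrix n n ℂ}
    (hD : D.IsHermitian) (hS : S.IsHermitian) : (D * S * D * S).trace.im = 0 := by
  rw [← Complex.conj_eq_iff_im, starRingEnd_apply, ← trace_conjTranspose]
  simp only [conjTranspose_mul, hD.eq, hS.eq]
  rw [trace_mul_comm]
  simp only [mul_assoc]

theorem exists_mean_add_sub {n : Type*} [Fintype n] (σ : ZMod 2 → Matrix n n ℂ)
    (hσ : ∀ x, (σ x).PosSemidef ∧ (σ x).trace = 1) :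
    ∃ R D : Matrix n n ℂ, R.PosSemidef ∧ R.trace = 1 ∧ D.IsHermitian ∧
      σ 0 = R + D ∧ σ 1 = R - D := by
  have hhalf : (0 : ℂ) ≤ 1/2 := by
    rw [show (1/2 : ℂ) = ((1/2 : ℝ) : ℂ) by norm_num]
    exact Complex.zero_le_real.mpr (by norm_num)
  refine ⟨(1/2 : ℂ) • (σ 0 + σ 1), (1/2 : ℂ) • (σ 0 - σ 1),
    ((hσ 0).1.add (hσ 1).1).smul hhalf, ?_, ?_, by module, by module⟩
  · rw [trace_smul, trace_add, (hσ 0).2, (hσ 1).2]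
    norm_num
  · rw [IsHermitian, conjTranspose_smul, conjTranspose_sub, (hσ 0).1.1.eq, (hσ 1).1.1.eq]
    simp

/-- **Pretty good measurement guessing probability of the combined check node.** -/
theorem pg_guess_combined
    {d1 d2 : Type*} [Fintype d1] [DecidableEq d1] [Fintype d2] [DecidableEq d2]
    (σ1 : ZMod 2 → Matrix d1 d1 ℂ) (σ2 : ZMod 2 → Matrix d2 d2 ℂ)
    (hσ1 : ∀ x, (σ1 x).PosSemidef ∧ (σ1 x).trace = 1)
    (hσ2 : ∀ x, (σ2 x).PosSemidef ∧ (σ2 x).trace = 1) :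
    pgGuess (fun _ : ZMod 2 => 1/2)
        (fun z => ((1/2 : ℝ) : ℂ) • ∑ x : ZMod 2, σ1 (z + x) ⊗ₖ σ2 x) =
      2 * (1/2 - pgGuess (fun _ : ZMod 2 => 1/2) σ1) *
        (1/2 - pgGuess (fun _ : ZMod 2 => 1/2) σ2) + 1/2 := by
  obtain ⟨R1, D1, hR1, ht1, hD1, h10, h11⟩ := exists_mean_add_sub σ1 hσ1
  obtain ⟨R2, D2, hR2, ht2, hD2, h20, h21⟩ := exists_mean_add_sub σ2 hσ2
  have hsum : ∀ f : ZMod 2 → Matrix (d1 × d2) (d1 × d2) ℂ, ∑ x, f x = f 0 + f 1 :=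
    Fin.sum_univ_two
  have h2 : (1 : ZMod 2) + 1 = 0 := rfl
  rw [pgGuess_add_sub hR1 ht1 h10 h11, pgGuess_add_sub hR2 ht2 h20 h21,
    pgGuess_add_sub (R := R1 ⊗ₖ R2) (D := D1 ⊗ₖ D2) (hR1.kronecker hR2)
      (by rw [trace_kronecker, ht1, ht2, one_mul]),
    mpow_kronecker hR1 hR2]
  · simp only [← mul_kronecker_mul, trace_kronecker, Complex.mul_re,
      trace_mul_mul_mul_im_eq_zero hD1 (mpow_isHermitian _ _)]
    ring
  · rw [hsum, add_zero, zero_add, h10, h11, h20, h21]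
    ext i j
    simp
    ring
  · rw [hsum, add_zero, h2, h10, h11, h20, h21]
    ext i j
    simp
    ring
end
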